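/- arXiv:1106.2440 — 2 statements merged into one kernel-verified Lean document; each statement's English description precedes it below -/
import Mathlib

section
/- Let n ≥ 1, let f : ℝ → ℝ, let k_1,…,k_n be reals, and write Δ⁻ = f(−1) − f(0). Let g be a graph on {1,…,n} with η_i(g) = k_i for all i, and let ij be a link of g. Then the change in firm i's profit from deleting the link ij satisfies the exact identity Y_i(g − ij) − Y_i(g) = −Δ⁻ · ((n−1)/(n+1)) · (2·q_i(g) − ((n−1)/(n+1))·Δ⁻). -/
open Finset

/-- The degree of vertex `i` in the simple graph `g`. -/
noncomputable def deg {n : ℕ} (g : SimpleGraph (Fin n)) (i : Fin n) : ℕ :=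
  Nat.card (g.neighborSet i)

/-- The graph obtained from `g` by deleting the link `ij`. -/
def delLink {n : ℕ} (g : SimpleGraph (Fin n)) (i j : Fin n) : SimpleGraph (Fin n) :=
  g.deleteEdges {s(i, j)}

/-- The graph obtained from `g` by adding the link `ij`. -/
def addLink {n : ℕ} (g : SimpleGraph (Fin n)) (i j : Fin n) : SimpleGraph (Fin n) :=
  g ⊔ SimpleGraph.fromEdgeSet {s(i, j)}

lemma delLink_comm {n : ℕ} (g : SimpleGraph (Fin n)) (i j : Fin n) :
    delLink g i j = delLink g j i := by
  rw [delLink, delLink, Sym2.eq_swap]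

lemma deg_delLink_left {n : ℕ} (g : SimpleGraph (Fin n)) {i j : Fin n} (hij : g.Adj i j) :
    deg (delLink g i j) i + 1 = deg g i := by
  have hset : (delLink g i j).neighborSet i = g.neighborSet i \ {j} := by
    ext l
    simp [delLink, SimpleGraph.deleteEdges_adj]
    grind
  rw [deg, deg, hset]
  exact Set.ncard_sdiff_singleton_add_one hij (Set.toFinite _)

lemma deg_delLink_right {n : ℕ} (g : SimpleGraph (Fin n)) {i j : Fin n} (hij : g.Adj i j) :
    deg (delLink g i j) j + 1 = deg g j := by
  rw [delLink_comm]
  exact deg_delLink_left g hij.symm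

lemma deg_delLink_of_ne {n : ℕ} (g : SimpleGraph (Fin n)) {i j l : Fin n} (hi : l ≠ i)
    (hj : l ≠ j) : deg (delLink g i j) l = deg g l := by
  have hset : (delLink g i j).neighborSet l = g.neighborSet l := by
    ext m
    simp [delLink, SimpleGraph.deleteEdges_adj, hi, hj]
  rw [deg, deg, hset]

/-- At the Cournot equilibrium with linear inverse demand, the markup of a firm equals its
quantity. -/
lemma cournot_markup_eq_quantity {n : ℕ} (α γ₀ : ℝ) (a q : Fin n → ℝ)
    (hq : ∀ i, q i = (α - γ₀ - n * a i + ∑ j ∈ univ.erase i, a j) / (n + 1)) (i : Fin n) :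
    α - ∑ j, q j - (γ₀ + a i) = q i := by
  have hn : (n : ℝ) + 1 ≠ 0 := by positivity
  have hq' : ∀ i, q i = (α - γ₀ + ∑ j, a j) / (n + 1) - a i := by
    intro i
    rw [hq, ← add_sum_erase univ a (mem_univ i)]
    field_simp
    ring
  have hsum : ∑ j, q j = n * ((α - γ₀ + ∑ j, a j) / (n + 1)) - ∑ j, a j := by
    simp [hq']
  rw [hsum, hq']
  field_simp
  ring

theorem stmt_9 (n : ℕ) (hn : 1 ≤ n) (α γ₀ : ℝ) (f : ℝ → ℝ) (k : Fin n → ℝ)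
    (q : SimpleGraph (Fin n) → Fin n → ℝ)
    (hq : ∀ g i, q g i = (α - γ₀ - n * f ((deg g i : ℝ) - k i)
      + ∑ j ∈ univ.erase i, f ((deg g j : ℝ) - k j)) / (n + 1))
    (P : SimpleGraph (Fin n) → ℝ) (hP : ∀ g, P g = α - ∑ j, q g j)
    (c : SimpleGraph (Fin n) → Fin n → ℝ)
    (hc : ∀ g i, c g i = γ₀ + f ((deg g i : ℝ) - k i))
    (Y : Fin n → SimpleGraph (Fin n) → ℝ)
    (hY : ∀ i g, Y i g = q g i * (P g - c g i))
    (Δ : ℝ) (hΔ : Δ = f (-1) - f 0)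
    (g : SimpleGraph (Fin n)) (hg : ∀ i, (deg g i : ℝ) = k i)
    (i j : Fin n) (hij : g.Adj i j) :
    Y i (delLink g i j) - Y i g =
      -Δ * (((n : ℝ) - 1) / ((n : ℝ) + 1)) *
        (2 * q g i - (((n : ℝ) - 1) / ((n : ℝ) + 1)) * Δ) := by
  have hprofit : ∀ g, Y i g = q g i ^ 2 := by
    intro g
    rw [hY, hP, hc, cournot_markup_eq_quantity α γ₀ (fun l => f ((deg g l : ℝ) - k l)) (q g) (hq g)]
    ring
  have hfg : ∀ l, f ((deg g l : ℝ) - k l) = f 0 := by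
    intro l
    rw [hg, sub_self]
  have hfi : f ((deg (delLink g i j) i : ℝ) - k i) = f 0 + Δ := by
    rw [hΔ, ← hg, ← deg_delLink_left g hij]
    push_cast
    ring_nf
  have hfj : f ((deg (delLink g i j) j : ℝ) - k j) = f 0 + Δ := by
    rw [hΔ, ← hg, ← deg_delLink_right g hij]
    push_cast
    ring_nf
  have hsum : ∑ l ∈ univ.erase i, f ((deg (delLink g i j) l : ℝ) - k l) =
      ∑ l ∈ univ.erase i, f ((deg g l : ℝ) - k l) + Δ := by
    have hj : j ∈ univ.erase i := mem_erase.2 ⟨hij.ne', mem_univ j⟩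
    rw [← add_sum_erase _ _ hj, ← add_sum_erase (univ.erase i) (fun l => f ((deg g l : ℝ) - k l)) hj,
      hfj, hfg, sum_congr rfl fun l hl => by
        rw [deg_delLink_of_ne g (mem_erase.1 (mem_erase.1 hl).2).1 (mem_erase.1 hl).1]]
    ring
  have hquantity : q (delLink g i j) i = q g i - ((n : ℝ) - 1) / ((n : ℝ) + 1) * Δ := by
    rw [hq, hq, hsum, hfi, hfg]
    ring
  rw [hprofit, hprofit, hquantity]
  ring
end

section
/- Let n ≥ 2 and let f : ℝ → ℝ satisfy: (1) f is strictly decreasing (x₁ > x₂ implies f(x₁) < f(x₂)); (2) f is convex; (3) f is positive; (4) α − γ₀ > n·f(0); and (5) f(k₁+1) − f(k₁) − n·(f(k₂+1) − f(k₂)) > 0 for all k₁, k₂ ∈ {0, 1, …, n−1}. Then the complete graph is the unique pairwise stable graph: for every graph g on {1,…,n} that is not complete and every pair of distinct non-adjacent vertices i, j of g, Y_i(g + ij) > Y_i(g) and Y_j(g + ij) > Y_j(g); hence g is not pairwise stable. -/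
open Finset

/-- Pairwise stability of a graph `g` with respect to payoffs `Y`. -/
def PairwiseStable {n : ℕ} (Y : Fin n → SimpleGraph (Fin n) → ℝ)
    (g : SimpleGraph (Fin n)) : Prop :=
  (∀ i j, g.Adj i j → Y i (delLink g i j) ≤ Y i g ∧ Y j (delLink g i j) ≤ Y j g) ∧
  (∀ i j, i ≠ j → ¬ g.Adj i j → (Y i g < Y i (addLink g i j) → Y j (addLink g i j) < Y j g))

theorem addLink_comm {n : ℕ} (g : SimpleGraph (Fin n)) (i j : Fin n) :
    addLink g i j = addLink g j i := by
  rw [addLink, addLink, Sym2.eq_swap]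

theorem deg_le {n : ℕ} (g : SimpleGraph (Fin n)) (i : Fin n) : deg g i ≤ n - 1 := by
  classical
  have h : deg g i = g.degree i := by
    rw [deg, Nat.card_eq_fintype_card, SimpleGraph.card_neighborSet_eq_degree]
  have := g.degree_lt_card_verts i
  rw [Fintype.card_fin] at this
  omega

theorem deg_addLink_left {n : ℕ} {g : SimpleGraph (Fin n)} {i j : Fin n} (hij : i ≠ j)
    (h : ¬ g.Adj i j) : deg (addLink g i j) i = deg g i + 1 := by
  have hs : (addLink g i j).neighborSet i = insert j (g.neighborSet i) := by
    ext k
    simp only [addLink, SimpleGraph.mem_neighborSet, SimpleGraph.sup_adj,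
      SimpleGraph.fromEdgeSet_adj, Set.mem_singleton_iff, Set.mem_insert_iff, Sym2.eq_iff]
    grind
  rw [deg, deg, hs, Nat.card_coe_set_eq, Nat.card_coe_set_eq,
    Set.ncard_insert_of_notMem (by simpa using h) (Set.toFinite _)]

theorem deg_addLink_right {n : ℕ} {g : SimpleGraph (Fin n)} {i j : Fin n} (hij : i ≠ j)
    (h : ¬ g.Adj i j) : deg (addLink g i j) j = deg g j + 1 := by
  rw [addLink_comm]
  exact deg_addLink_left hij.symm fun h' => h h'.symm

theorem deg_addLink_of_ne {n : ℕ} (g : SimpleGraph (Fin n)) {i j k : Fin n} (hi : k ≠ i)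
    (hj : k ≠ j) : deg (addLink g i j) k = deg g k := by
  have hs : (addLink g i j).neighborSet k = g.neighborSet k := by
    ext l
    simp only [addLink, SimpleGraph.mem_neighborSet, SimpleGraph.sup_adj,
      SimpleGraph.fromEdgeSet_adj, Set.mem_singleton_iff, Sym2.eq_iff]
    grind
  rw [deg, deg, hs]

/-- Cournot profits equal squared quantities: the price-cost margin is the quantity. -/
theorem margin_eq_quantity {n : ℕ} (A γ : ℝ) (x q : Fin n → ℝ)
    (hq : ∀ i, q i = (A - γ - n * x i + ∑ j ∈ univ.erase i, x j) / (n + 1)) (i : Fin n) :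
    A - ∑ j, q j - (γ + x i) = q i := by
  have hn : (n : ℝ) + 1 ≠ 0 := by positivity
  have hq' : ∀ i, q i = (A - γ + ∑ j, x j) / (n + 1) - x i := fun i => by
    rw [hq, ← Finset.add_sum_erase univ x (mem_univ i)]
    field_simp
    ring
  have hsum : ∑ j, q j = n * ((A - γ + ∑ j, x j) / (n + 1)) - ∑ j, x j := by
    simp [hq', Finset.sum_sub_distrib]
  rw [hsum, hq']
  field_simp
  ring

theorem stmt_13 (n : ℕ) (hn : 2 ≤ n) (α γ₀ : ℝ) (f : ℝ → ℝ)
    (hdec : ∀ x₁ x₂ : ℝ, x₂ < x₁ → f x₁ < f x₂)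
    (hconv : ConvexOn ℝ Set.univ f)
    (hpos : ∀ x : ℝ, 0 < f x)
    (hparam : α - γ₀ > n * f 0)
    (hsteep : ∀ k₁ k₂ : ℕ, k₁ ≤ n - 1 → k₂ ≤ n - 1 →
      (f ((k₁ : ℝ) + 1) - f (k₁ : ℝ)) - n * (f ((k₂ : ℝ) + 1) - f (k₂ : ℝ)) > 0)
    (q : SimpleGraph (Fin n) → Fin n → ℝ)
    (hq : ∀ g i, q g i = (α - γ₀ - n * f (deg g i : ℝ)
      + ∑ j ∈ univ.erase i, f (deg g j : ℝ)) / (n + 1))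
    (P : SimpleGraph (Fin n) → ℝ) (hP : ∀ g, P g = α - ∑ j, q g j)
    (c : SimpleGraph (Fin n) → Fin n → ℝ)
    (hc : ∀ g i, c g i = γ₀ + f (deg g i : ℝ))
    (Y : Fin n → SimpleGraph (Fin n) → ℝ)
    (hY : ∀ i g, Y i g = q g i * (P g - c g i)) :
    ∀ g : SimpleGraph (Fin n), g ≠ (⊤ : SimpleGraph (Fin n)) →
      (∀ i j : Fin n, i ≠ j → ¬ g.Adj i j →
        Y i g < Y i (addLink g i j) ∧ Y j g < Y j (addLink g i j)) ∧
      ¬ PairwiseStable Y g := by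
  have hprofit : ∀ i g, Y i g = q g i ^ 2 := fun i g => by
    rw [hY, hP, hc, margin_eq_quantity α γ₀ (fun k => f (deg g k)) (q g) (hq g) i, sq]
  have hqpos : ∀ g i, 0 < q g i := fun g i => by
    rw [hq]
    have hle : f (deg g i) ≤ f 0 :=
      (show StrictAnti f from fun a b hab => hdec b a hab).antitone (Nat.cast_nonneg _)
    have hmul : (n : ℝ) * f (deg g i) ≤ n * f 0 := by gcongr
    have hsum : 0 ≤ ∑ j ∈ univ.erase i, f (deg g j) := sum_nonneg fun j _ => (hpos _).le
    exact div_pos (by linarith) (by positivity)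
  have gain : ∀ (g : SimpleGraph (Fin n)) (i j : Fin n), i ≠ j → ¬ g.Adj i j →
      Y i g < Y i (addLink g i j) := fun g i j hij h => by
    rw [hprofit, hprofit]
    refine pow_lt_pow_left₀ ?_ (hqpos g i).le two_ne_zero
    have hj : j ∈ univ.erase i := by simp [hij.symm]
    have hrest : ∑ k ∈ (univ.erase i).erase j, f (deg (addLink g i j) k) =
        ∑ k ∈ (univ.erase i).erase j, f (deg g k) := by
      refine sum_congr rfl fun k hk => ?_
      simp only [mem_erase] at hk
      rw [deg_addLink_of_ne g hk.2.1 hk.1]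
    rw [hq, hq, ← add_sum_erase _ _ hj, ← add_sum_erase _ _ hj, hrest,
      deg_addLink_left hij h, deg_addLink_right hij h]
    have := hsteep (deg g j) (deg g i) (deg_le g j) (deg_le g i)
    push_cast
    gcongr ?_ / _
    linarith
  intro g hg
  have hboth : ∀ i j : Fin n, i ≠ j → ¬ g.Adj i j →
      Y i g < Y i (addLink g i j) ∧ Y j g < Y j (addLink g i j) := fun i j hij h =>
    ⟨gain g i j hij h, addLink_comm g i j ▸ gain g j i hij.symm fun h' => h h'.symm⟩
  refine ⟨hboth, fun hstable => hg ?_⟩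
  ext i j
  rw [SimpleGraph.top_adj]
  refine ⟨fun h => h.ne, fun hij => by_contra fun h => ?_⟩
  obtain ⟨hi, hj⟩ := hboth i j hij h
  exact (hstable.2 i j hij h hi).not_gt hj
end
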